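/- ∑_{k=0}^∞ (7/2)_k (−5/4)_k (−3/4)_k / [(k!)^2 · (k+3)!] · (8k+7)/9^k = 1024√3/(405π). -/

import Mathlib

/-- The Pochhammer symbol `(x)ₖ = x (x+1) ⋯ (x+k-1)`, with `(x)₀ = 1`. -/
noncomputable def poch (x : ℝ) (k : ℕ) : ℝ :=
  ∏ i ∈ Finset.range k, (x + i)

open Filter Topology Finset

/-- The ratio of consecutive terms (in `k`) of `cubicCoeff n`. -/
noncomputable def cubicStep (n k : ℕ) : ℝ :=
  ((6 * n + 7 + 2 * k) * (7 + 2 * k) * (4 * k - 5) * (4 * k - 3)) /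
    (144 * (k + 1) * (n + 1 + k) * (3 * n + 7 + 2 * k) * (3 * n + 8 + 2 * k))

/-- With `a = 3 n + 7/2` and `b = 7/2`, the quotient
`(a)ₖ (b)ₖ (1 - b)₂ₖ / (k! (1 + (a - b)/3)ₖ (a + b)₂ₖ 9ᵏ)`. -/
noncomputable def cubicCoeff (n k : ℕ) : ℝ :=
  ∏ i ∈ range k, cubicStep n i

/-- The summand of the cubic hypergeometric series with `a = 3 n + 7/2` and `b = 7/2`. -/
noncomputable def cubicTerm (n k : ℕ) : ℝ :=
  (1 + 8 * k / (6 * n + 7)) * cubicCoeff n k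

/-- The ratio of consecutive sums (in `n`) of the series of `cubicTerm n`. -/
noncomputable def sumRatio (n : ℕ) : ℝ :=
  (16 * (n + 1) * (n + 3) * (3 * n + 7) * (3 * n + 8)) /
    ((6 * n + 11) * (6 * n + 13) * (2 * n + 3) * (2 * n + 7))

/-- The Wilf–Zeilberger companion of `cubicTerm`. -/
noncomputable def companion (n k : ℕ) : ℝ :=
  sumRatio n * cubicCoeff n k * (9 * k * (2 * k + 4 * n + 7)) /
    ((6 * n + 7) * (3 * n + 7 + 2 * k))

lemma cubicCoeff_succ (n k : ℕ) :
    cubicCoeff n (k + 1) = cubicCoeff n k * cubicStep n k :=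
  prod_range_succ _ _

lemma cubicCoeff_shift (n k : ℕ) :
    cubicCoeff (n + 1) k = cubicCoeff n k *
      (((6 * n + 7 + 2 * k) * (6 * n + 9 + 2 * k) * (6 * n + 11 + 2 * k) * (n + 1) *
        ((3 * n + 7) * (3 * n + 8) * (3 * n + 9))) /
      ((6 * n + 7) * (6 * n + 9) * (6 * n + 11) * (n + 1 + k) *
        ((3 * n + 7 + 2 * k) * (3 * n + 8 + 2 * k) * (3 * n + 9 + 2 * k)))) := by
  induction k with
  | zero =>
    simp only [cubicCoeff, range_zero, prod_empty, Nat.cast_zero, mul_zero, add_zero, one_mul]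
    field_simp
  | succ k ih =>
    rw [cubicCoeff_succ, cubicCoeff_succ, ih, mul_assoc (cubicCoeff n k),
      mul_assoc (cubicCoeff n k)]
    congr 1
    simp only [cubicStep]
    push_cast
    field_simp
    ring

lemma cubicTerm_succ_sub (n k : ℕ) :
    cubicTerm (n + 1) k - sumRatio n * cubicTerm n k =
      companion n (k + 1) - companion n k := by
  simp only [cubicTerm, companion, cubicCoeff_shift, cubicCoeff_succ, cubicStep, sumRatio]
  push_cast
  field_simp
  ring

lemma abs_cubicStep_le (n k : ℕ) :
    |cubicStep n k| ≤ 1 / 2 * ((7 + 2 * k) / (3 * n + 7 + 2 * k)) := by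
  have hn : (0 : ℝ) ≤ n := n.cast_nonneg
  have hk : (0 : ℝ) ≤ k := k.cast_nonneg
  have split : cubicStep n k = ((6 * n + 7 + 2 * k) / (n + 1 + k) * ((4 * k - 5) / (k + 1)) *
      ((4 * k - 3) / (3 * n + 8 + 2 * k)) / 144) * ((7 + 2 * k) / (3 * n + 7 + 2 * k)) := by
    simp only [cubicStep]
    field_simp
  have h1 : |(6 * n + 7 + 2 * k) / (n + 1 + k : ℝ)| ≤ 7 := by
    rw [abs_of_nonneg (by positivity), div_le_iff₀ (by positivity)]
    linarith
  have h2 : |(4 * k - 5) / (k + 1 : ℝ)| ≤ 5 := by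
    rw [abs_div, abs_of_pos (by positivity : (0 : ℝ) < k + 1), div_le_iff₀ (by positivity),
      abs_le]
    constructor <;> linarith
  have h3 : |(4 * k - 3) / (3 * n + 8 + 2 * k : ℝ)| ≤ 2 := by
    rw [abs_div, abs_of_pos (by positivity : (0 : ℝ) < 3 * n + 8 + 2 * k),
      div_le_iff₀ (by positivity), abs_le]
    constructor <;> linarith
  have h4 : (0 : ℝ) ≤ (7 + 2 * k) / (3 * n + 7 + 2 * k) := by positivity
  rw [split, abs_mul, abs_of_nonneg h4]
  refine mul_le_mul_of_nonneg_right ?_ h4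
  rw [abs_div, abs_mul, abs_mul, abs_of_pos (by norm_num : (0 : ℝ) < 144)]
  calc _ ≤ (7 * 5 * 2 : ℝ) / 144 := by gcongr
    _ ≤ 1 / 2 := by norm_num

lemma abs_cubicCoeff_le (n k : ℕ) : |cubicCoeff n k| ≤ (1 / 2) ^ k := by
  rw [cubicCoeff, abs_prod, ← card_range k, ← prod_const, card_range]
  refine prod_le_prod (fun _ _ => abs_nonneg _) fun i _ => (abs_cubicStep_le n i).trans ?_
  refine mul_le_of_le_one_right (by norm_num) (div_le_one_of_le₀ ?_ (by positivity))
  have hn : (0 : ℝ) ≤ n := n.cast_nonneg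
  linarith

lemma abs_cubicTerm_le (n k : ℕ) : |cubicTerm n k| ≤ (1 + 2 * k) * (1 / 2) ^ k := by
  have hn : (0 : ℝ) ≤ n := n.cast_nonneg
  have hk : (0 : ℝ) ≤ k := k.cast_nonneg
  rw [cubicTerm, abs_mul, abs_of_nonneg (by positivity)]
  refine mul_le_mul ?_ (abs_cubicCoeff_le n k) (abs_nonneg _) (by positivity)
  gcongr
  rw [div_le_iff₀ (by positivity)]
  nlinarith [mul_nonneg hn hk]

lemma summable_cubicTerm_bound : Summable fun k : ℕ => (1 + 2 * k : ℝ) * (1 / 2) ^ k := by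
  have h0 : Summable fun k : ℕ => (1 / 2 : ℝ) ^ k := summable_geometric_two
  have h1 : Summable fun k : ℕ => (k : ℝ) ^ 1 * (1 / 2 : ℝ) ^ k :=
    summable_pow_mul_geometric_of_norm_lt_one 1 (by norm_num)
  refine (h0.add (h1.mul_left 2)).congr fun k => ?_
  ring

lemma summable_cubicTerm (n : ℕ) : Summable (cubicTerm n) :=
  summable_cubicTerm_bound.of_norm_bounded fun k => abs_cubicTerm_le n k

lemma tendsto_companion (n : ℕ) : Tendsto (companion n) atTop (𝓝 0) := by
  have hn : (0 : ℝ) ≤ n := n.cast_nonneg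
  have hr : 0 ≤ sumRatio n := by unfold sumRatio; positivity
  have hlim := (summable_cubicTerm_bound.mul_left (9 * sumRatio n)).tendsto_atTop_zero
  refine squeeze_zero_norm (fun k => ?_) hlim
  have hk : (0 : ℝ) ≤ k := k.cast_nonneg
  have split : companion n k = sumRatio n *
      (9 * k * (2 * k + 4 * n + 7) / ((6 * n + 7) * (3 * n + 7 + 2 * k))) *
      cubicCoeff n k := by
    simp only [companion]
    ring
  rw [Real.norm_eq_abs, split, abs_mul, abs_of_nonneg (by positivity), ← mul_assoc]
  refine mul_le_mul ?_ (abs_cubicCoeff_le n k) (abs_nonneg _) (by positivity)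
  rw [mul_comm 9 (sumRatio n), mul_assoc (sumRatio n)]
  refine mul_le_mul_of_nonneg_left ?_ hr
  rw [div_le_iff₀ (by positivity)]
  have h : (2 * k + 4 * n + 7 : ℝ) ≤ (6 * n + 7) * (3 * n + 7 + 2 * k) := by
    nlinarith [mul_nonneg hn hk, mul_nonneg hn hn]
  calc (9 * k * (2 * k + 4 * n + 7) : ℝ)
      ≤ 9 * (1 + 2 * k) * ((6 * n + 7) * (3 * n + 7 + 2 * k)) := by
        gcongr
        linarith
    _ = _ := by ring

lemma tsum_cubicTerm_succ (n : ℕ) :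
    ∑' k, cubicTerm (n + 1) k = sumRatio n * ∑' k, cubicTerm n k := by
  have hs := ((summable_cubicTerm (n + 1)).hasSum.sub
    ((summable_cubicTerm n).hasSum.mul_left (sumRatio n))).tendsto_sum_nat
  have ht : Tendsto (fun N => ∑ k ∈ range N,
      (cubicTerm (n + 1) k - sumRatio n * cubicTerm n k)) atTop (𝓝 0) := by
    have h0 : companion n 0 = 0 := by simp [companion]
    simpa only [cubicTerm_succ_sub, sum_range_sub, h0, sub_zero] using tendsto_companion n
  exact sub_eq_zero.mp (tendsto_nhds_unique hs ht)

lemma tsum_cubicTerm_eq_prod (n : ℕ) :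
    ∑' k, cubicTerm n k = (∏ i ∈ range n, sumRatio i) * ∑' k, cubicTerm 0 k := by
  induction n with
  | zero => simp
  | succ n ih => rw [tsum_cubicTerm_succ, ih, prod_range_succ]; ring

lemma tendsto_cubicTerm_succ (k : ℕ) :
    Tendsto (fun n => cubicTerm n (k + 1)) atTop (𝓝 0) := by
  have hlim : Tendsto (fun n : ℕ => ((1 + 2 * (k + 1)) * (7 + 2 * k) : ℝ) * (1 / ((n : ℝ) + 1)))
      atTop (𝓝 0) := by
    simpa using tendsto_one_div_add_atTop_nhds_zero_nat.const_mul
      ((1 + 2 * (k + 1)) * (7 + 2 * k) : ℝ)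
  refine squeeze_zero_norm (fun n => ?_) hlim
  have hn : (0 : ℝ) ≤ n := n.cast_nonneg
  have hk : (0 : ℝ) ≤ k := k.cast_nonneg
  have hc : |cubicCoeff n k| ≤ 1 :=
    (abs_cubicCoeff_le n k).trans (pow_le_one₀ (by norm_num) (by norm_num))
  have hstep : |cubicStep n k| ≤ (7 + 2 * k) * (1 / ((n : ℝ) + 1)) := by
    refine (abs_cubicStep_le n k).trans ?_
    calc (1 / 2 * ((7 + 2 * k) / (3 * n + 7 + 2 * k)) : ℝ)
        ≤ 1 * ((7 + 2 * k) / (n + 1)) := by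
          gcongr ?_ * (_ / ?_)
          · norm_num
          · linarith
      _ = _ := by ring
  have hfac : (1 + 8 * ((k + 1 : ℕ) : ℝ) / (6 * n + 7)) ≤ 1 + 2 * (k + 1) := by
    push_cast
    gcongr
    rw [div_le_iff₀ (by positivity)]
    nlinarith [mul_nonneg hn hk]
  rw [Real.norm_eq_abs, cubicTerm, cubicCoeff_succ, abs_mul, abs_mul,
    abs_of_nonneg (by positivity), mul_assoc]
  refine mul_le_mul hfac ?_ (by positivity) (by positivity)
  calc _ ≤ 1 * ((7 + 2 * k) * (1 / ((n : ℝ) + 1))) := by gcongr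
    _ = _ := one_mul _

lemma tendsto_tsum_cubicTerm : Tendsto (fun n => ∑' k, cubicTerm n k) atTop (𝓝 1) := by
  have h := tendsto_tsum_of_dominated_convergence (f := cubicTerm) (𝓕 := atTop)
    (g := fun k => if k = 0 then (1 : ℝ) else 0) summable_cubicTerm_bound
    (fun k => by
      cases k with
      | zero => simp [cubicTerm, cubicCoeff]
      | succ k => simpa using tendsto_cubicTerm_succ k)
    (Eventually.of_forall fun n k => abs_cubicTerm_le n k)
  simpa using h

lemma prod_sumRatio_eq_GammaSeq {n : ℕ} (hn : n ≠ 0) :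
    ∏ i ∈ range (n + 1), sumRatio i =
      (Real.GammaSeq (11 / 6) n * Real.GammaSeq (13 / 6) n *
        Real.GammaSeq (3 / 2) n * Real.GammaSeq (7 / 2) n) /
      (Real.GammaSeq 1 n * Real.GammaSeq 3 n *
        Real.GammaSeq (7 / 3) n * Real.GammaSeq (8 / 3) n) := by
  have hn' : (0 : ℝ) < n := by exact_mod_cast Nat.pos_of_ne_zero hn
  have hratio (i : ℕ) : sumRatio i =
      ((1 + i) * (3 + i) * (7 / 3 + i) * (8 / 3 + i)) /
        ((11 / 6 + i) * (13 / 6 + i) * (3 / 2 + i) * (7 / 2 + i)) := by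
    simp only [sumRatio]
    field_simp
    ring
  have hpos (s : ℝ) (hs : 0 < s) : ∏ j ∈ range (n + 1), (s + j) ≠ 0 :=
    (prod_pos fun j _ => by positivity).ne'
  have hpow : (n : ℝ) ^ (11 / 6 : ℝ) * (n : ℝ) ^ (13 / 6 : ℝ) * (n : ℝ) ^ (3 / 2 : ℝ) *
      (n : ℝ) ^ (7 / 2 : ℝ) = (n : ℝ) ^ (1 : ℝ) * (n : ℝ) ^ (3 : ℝ) * (n : ℝ) ^ (7 / 3 : ℝ) *
      (n : ℝ) ^ (8 / 3 : ℝ) := by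
    simp only [← Real.rpow_add hn']
    norm_num
  have hfac : (n.factorial : ℝ) ≠ 0 := by positivity
  have h1 := hpos 1 (by norm_num)
  have h2 := hpos 3 (by norm_num)
  have h3 := hpos (7 / 3) (by norm_num)
  have h4 := hpos (8 / 3) (by norm_num)
  have h5 := hpos (11 / 6) (by norm_num)
  have h6 := hpos (13 / 6) (by norm_num)
  have h7 := hpos (3 / 2) (by norm_num)
  have h8 := hpos (7 / 2) (by norm_num)
  have p (s : ℝ) : (n : ℝ) ^ s ≠ 0 := (Real.rpow_pos_of_pos hn' s).ne'
  have q1 := p 1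
  have q2 := p 3
  have q3 := p (7 / 3)
  have q4 := p (8 / 3)
  simp only [hratio, prod_div_distrib, prod_mul_distrib, Real.GammaSeq]
  generalize ∏ j ∈ range (n + 1), (1 + (j : ℝ)) = P1 at *
  generalize ∏ j ∈ range (n + 1), (3 + (j : ℝ)) = P2 at *
  generalize ∏ j ∈ range (n + 1), (7 / 3 + (j : ℝ)) = P3 at *
  generalize ∏ j ∈ range (n + 1), (8 / 3 + (j : ℝ)) = P4 at *
  generalize ∏ j ∈ range (n + 1), (11 / 6 + (j : ℝ)) = P5 at *
  generalize ∏ j ∈ range (n + 1), (13 / 6 + (j : ℝ)) = P6 at *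
  generalize ∏ j ∈ range (n + 1), (3 / 2 + (j : ℝ)) = P7 at *
  generalize ∏ j ∈ range (n + 1), (7 / 2 + (j : ℝ)) = P8 at *
  clear hpos hratio p
  generalize (n : ℝ) ^ (1 : ℝ) = Q1 at *
  generalize (n : ℝ) ^ (3 : ℝ) = Q2 at *
  generalize (n : ℝ) ^ (7 / 3 : ℝ) = Q3 at *
  generalize (n : ℝ) ^ (8 / 3 : ℝ) = Q4 at *
  generalize (n : ℝ) ^ (11 / 6 : ℝ) = Q5 at *
  generalize (n : ℝ) ^ (13 / 6 : ℝ) = Q6 at *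
  generalize (n : ℝ) ^ (3 / 2 : ℝ) = Q7 at *
  generalize (n : ℝ) ^ (7 / 2 : ℝ) = Q8 at *
  rw [div_eq_div_iff (by positivity) (by positivity)]
  field_simp
  linear_combination (-1 : ℝ) * hpow

lemma Gamma_quotient_eq :
    (Real.Gamma (11 / 6) * Real.Gamma (13 / 6) * Real.Gamma (3 / 2) * Real.Gamma (7 / 2)) /
      (Real.Gamma 1 * Real.Gamma 3 * Real.Gamma (7 / 3) * Real.Gamma (8 / 3)) =
    945 * Real.pi / (2048 * Real.sqrt 3) := by
  have step (s : ℝ) (hs : s ≠ 0) {t : ℝ} (ht : t = s + 1) :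
      Real.Gamma t = s * Real.Gamma s := ht ▸ Real.Gamma_add_one hs
  have sixth : Real.Gamma (1 / 6) * Real.Gamma (5 / 6) = 2 * Real.pi := by
    have h := Real.Gamma_mul_Gamma_one_sub (1 / 6)
    rw [show Real.pi * (1 / 6) = Real.pi / 6 by ring, Real.sin_pi_div_six] at h
    norm_num at h ⊢
    linarith
  have third : Real.Gamma (1 / 3) * Real.Gamma (2 / 3) = 2 * Real.pi / Real.sqrt 3 := by
    have h := Real.Gamma_mul_Gamma_one_sub (1 / 3)
    rw [show Real.pi * (1 / 3) = Real.pi / 3 by ring, Real.sin_pi_div_three,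
      show (1 - 1 / 3 : ℝ) = 2 / 3 by norm_num] at h
    rw [h]
    field_simp
  have half : Real.Gamma (1 / 2) * Real.Gamma (1 / 2) = Real.pi := by
    rw [Real.Gamma_one_half_eq, Real.mul_self_sqrt Real.pi_pos.le]
  have two : Real.Gamma 3 = 2 := by
    rw [step 2 (by norm_num) (by norm_num), Real.Gamma_two, mul_one]
  have num : Real.Gamma (11 / 6) * Real.Gamma (13 / 6) * Real.Gamma (3 / 2) *
      Real.Gamma (7 / 2) = 175 / 1152 * (Real.Gamma (1 / 6) * Real.Gamma (5 / 6)) *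
        (Real.Gamma (1 / 2) * Real.Gamma (1 / 2)) := by
    rw [step (5 / 6) (by norm_num) (t := 11 / 6) (by norm_num),
      step (7 / 6) (by norm_num) (t := 13 / 6) (by norm_num),
      step (1 / 6) (by norm_num) (t := 7 / 6) (by norm_num),
      step (5 / 2) (by norm_num) (t := 7 / 2) (by norm_num),
      step (3 / 2) (by norm_num) (t := 5 / 2) (by norm_num),
      step (1 / 2) (by norm_num) (t := 3 / 2) (by norm_num)]
    ring
  have den : Real.Gamma 1 * Real.Gamma 3 * Real.Gamma (7 / 3) * Real.Gamma (8 / 3) =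
      80 / 81 * (Real.Gamma (1 / 3) * Real.Gamma (2 / 3)) := by
    rw [Real.Gamma_one, two, step (4 / 3) (by norm_num) (t := 7 / 3) (by norm_num),
      step (1 / 3) (by norm_num) (t := 4 / 3) (by norm_num),
      step (5 / 3) (by norm_num) (t := 8 / 3) (by norm_num),
      step (2 / 3) (by norm_num) (t := 5 / 3) (by norm_num)]
    ring
  have hpi := Real.pi_pos
  have hsq : Real.sqrt 3 ^ 2 = 3 := Real.sq_sqrt (by norm_num)
  rw [num, den, sixth, third, half]
  field_simp
  rw [hsq]
  norm_num

lemma tendsto_prod_sumRatio :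
    Tendsto (fun n => ∏ i ∈ range n, sumRatio i) atTop
      (𝓝 (945 * Real.pi / (2048 * Real.sqrt 3))) := by
  rw [← Gamma_quotient_eq, ← tendsto_add_atTop_iff_nat 1]
  have hG := Real.GammaSeq_tendsto_Gamma
  refine Tendsto.congr' ?_ (((((hG (11 / 6)).mul (hG (13 / 6))).mul (hG (3 / 2))).mul
    (hG (7 / 2))).div ((((hG 1).mul (hG 3)).mul (hG (7 / 3))).mul (hG (8 / 3))) ?_)
  · filter_upwards [eventually_ne_atTop 0] with n hn
    exact (prod_sumRatio_eq_GammaSeq hn).symm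
  · have h (s : ℝ) (hs : 0 < s) : Real.Gamma s ≠ 0 := (Real.Gamma_pos_of_pos hs).ne'
    have h1 := h 1 (by norm_num)
    have h2 := h 3 (by norm_num)
    have h3 := h (7 / 3) (by norm_num)
    have h4 := h (8 / 3) (by norm_num)
    positivity

lemma poch_succ (x : ℝ) (k : ℕ) : poch x (k + 1) = poch x k * (x + k) :=
  prod_range_succ _ _

lemma poch_term_eq_cubicCoeff (k : ℕ) :
    (poch (7/2) k * poch (-(5/4)) k * poch (-(3/4)) k) /
      ((k.factorial : ℝ) ^ 2 * ((k + 3).factorial : ℝ)) / (9 : ℝ) ^ k =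
    cubicCoeff 0 k / 6 := by
  induction k with
  | zero => norm_num [poch, cubicCoeff, Nat.factorial]
  | succ k ih =>
    rw [cubicCoeff_succ, mul_div_right_comm (cubicCoeff 0 k), ← ih,
      show k + 1 + 3 = k + 3 + 1 by ring,
      Nat.factorial_succ, Nat.factorial_succ (k + 3)]
    simp only [poch_succ, cubicStep]
    push_cast
    field_simp
    ring

theorem example_thm5_p1q1 :
    ∑' k : ℕ, (poch (7/2) k * poch (-(5/4)) k * poch (-(3/4)) k) / ((k.factorial : ℝ) ^ 2 * ((k + 3).factorial : ℝ)) * ((8*(k : ℝ) + 7) / (9 : ℝ) ^ k) = 1024 * Real.sqrt 3 / (405 * Real.pi) := by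
  have hterm (k : ℕ) : (poch (7/2) k * poch (-(5/4)) k * poch (-(3/4)) k) /
      ((k.factorial : ℝ) ^ 2 * ((k + 3).factorial : ℝ)) * ((8*(k : ℝ) + 7) / (9 : ℝ) ^ k) =
      7 / 6 * cubicTerm 0 k := by
    rw [mul_div_left_comm, poch_term_eq_cubicCoeff, cubicTerm]
    push_cast
    ring
  have hlim := tendsto_prod_sumRatio.mul_const (∑' k, cubicTerm 0 k)
  simp only [← tsum_cubicTerm_eq_prod] at hlim
  have hS := tendsto_nhds_unique hlim tendsto_tsum_cubicTerm
  rw [tsum_congr hterm, tsum_mul_left]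
  have hpi := Real.pi_pos
  have hsq : Real.sqrt 3 ^ 2 = 3 := Real.sq_sqrt (by norm_num)
  field_simp at hS ⊢
  nlinarith [hS, hsq]
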